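/- Let G be a finite group with trivial center and let Q ⊆ G be a conjugacy class of G that generates G, regarded as a rack with x^y = y⁻¹xy. Let A = ℚ⟦h⟧ be the ring of formal power series over ℚ and m = (h). Then c_Q is rigid: for every Yang-Baxter deformation c of c_Q with respect to m there exists a power series s ∈ ℚ⟦h⟧ with s ≡ 1 mod (h) such that c is equivalent to the rescaled operator s·c_Q. -/

import Mathlib

open TensorProduct

noncomputable section

/-- A rack: a set with a binary operation `act x y = x ^ y` such that all right
translations are bijective and the operation is right self-distributive. -/
structure YBRack (Q : Type*) where
  act : Q → Q → Q
  act_bijective : ∀ y : Q, Function.Bijective fun x => act x y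
  self_distrib : ∀ x y z : Q, act (act x y) z = act (act x z) (act y z)

namespace YBRack

variable {Q : Type*} {A : Type*} [CommRing A]

/-- Right translation by `y` as a permutation of `Q`. -/
def rho (R : YBRack Q) (y : Q) : Equiv.Perm Q :=
  Equiv.ofBijective _ (R.act_bijective y)

/-- The inner automorphism group of a rack: the subgroup of `Perm Q` generated
by all right translations. -/
def Inn (R : YBRack Q) : Subgroup (Equiv.Perm Q) :=
  Subgroup.closure (Set.range R.rho)

/-- Behavioural equivalence: `x ≡ y` iff `ϱ(x) = ϱ(y)`. -/
def BEquiv (R : YBRack Q) (x y : Q) : Prop := R.rho x = R.rho y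

end YBRack
/-- Matrix of a linear endomorphism of `AQ ⊗ AQ`, via the identification of
`AQ ⊗ AQ` with the free module on `Q × Q`. -/
def mat2 (A : Type*) [CommRing A] {Q : Type*}
    (f : ((Q →₀ A) ⊗[A] (Q →₀ A)) →ₗ[A] ((Q →₀ A) ⊗[A] (Q →₀ A))) (p q : Q × Q) : A :=
  finsuppTensorFinsupp' A Q Q (f ((finsuppTensorFinsupp' A Q Q).symm (Finsupp.single p 1))) q

/-- Matrix of a linear endomorphism of `AQ`. -/
def mat1 (A : Type*) [CommRing A] {Q : Type*}
    (f : (Q →₀ A) →ₗ[A] (Q →₀ A)) (x u : Q) : A :=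
  f (Finsupp.single x 1) u

/-- The Yang–Baxter (braid) equation for an endomorphism of `M ⊗ M`, where
`c₁ = c ⊗ id` and `c₂ = id ⊗ c` act on `(M ⊗ M) ⊗ M`. -/
def YBE {A M : Type*} [CommRing A] [AddCommGroup M] [Module A M]
    (c : (M ⊗[A] M) →ₗ[A] (M ⊗[A] M)) : Prop :=
  (LinearMap.rTensor M c) ∘ₗ
      ((TensorProduct.assoc A M M M).symm.toLinearMap ∘ₗ (LinearMap.lTensor M c) ∘ₗ
        (TensorProduct.assoc A M M M).toLinearMap) ∘ₗ (LinearMap.rTensor M c)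
    = ((TensorProduct.assoc A M M M).symm.toLinearMap ∘ₗ (LinearMap.lTensor M c) ∘ₗ
        (TensorProduct.assoc A M M M).toLinearMap) ∘ₗ (LinearMap.rTensor M c) ∘ₗ
      ((TensorProduct.assoc A M M M).symm.toLinearMap ∘ₗ (LinearMap.lTensor M c) ∘ₗ
        (TensorProduct.assoc A M M M).toLinearMap)

/-- A Yang–Baxter operator: a bijective linear endomorphism of `M ⊗ M`
satisfying the Yang–Baxter equation. -/
def IsYBOp {A M : Type*} [CommRing A] [AddCommGroup M] [Module A M]
    (c : (M ⊗[A] M) →ₗ[A] (M ⊗[A] M)) : Prop :=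
  Function.Bijective c ∧ YBE c

/-- An endomorphism of `AQ ⊗ AQ` is entropic (with respect to the rack `R`)
if its matrix is quasi-diagonal and fully equivariant. -/
def Entropic2 {Q : Type*} (R : YBRack Q) (A : Type*) [CommRing A]
    (f : ((Q →₀ A) ⊗[A] (Q →₀ A)) →ₗ[A] ((Q →₀ A) ⊗[A] (Q →₀ A))) : Prop :=
  (∀ x y u v : Q, (¬ R.BEquiv x u ∨ ¬ R.BEquiv y v) → mat2 A f (x, y) (u, v) = 0) ∧
  (∀ (x y u v : Q) (α β : R.Inn),
    mat2 A f ((α : Equiv.Perm Q) x, (β : Equiv.Perm Q) y)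
        ((α : Equiv.Perm Q) u, (β : Equiv.Perm Q) v)
      = mat2 A f (x, y) (u, v))

open scoped Classical in
/-- Two Yang–Baxter operators are equivalent with respect to the ideal `m` if
they are conjugate by `α ⊗ α` for some automorphism `α` of `AQ` congruent to
the identity modulo `m`. -/
def YBEquivalent {Q A : Type*} [CommRing A] (m : Ideal A)
    (c c' : ((Q →₀ A) ⊗[A] (Q →₀ A)) →ₗ[A] ((Q →₀ A) ⊗[A] (Q →₀ A))) : Prop :=
  ∃ α : (Q →₀ A) ≃ₗ[A] (Q →₀ A),
    (∀ x u : Q, (α (Finsupp.single x 1)) u - (if x = u then 1 else 0) ∈ m) ∧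
    c' = (TensorProduct.congr α α).toLinearMap ∘ₗ c ∘ₗ (TensorProduct.congr α α).symm.toLinearMap

namespace YBRack

variable {Q : Type*}

@[simp]
theorem rho_apply (R : YBRack Q) (y x : Q) : R.rho y x = R.act x y := rfl

theorem act_inj (R : YBRack Q) {x u : Q} (y : Q) : R.act x y = R.act u y ↔ x = u :=
  (R.act_bijective y).injective.eq_iff

theorem exists_act_ne (R : YBRack Q) (hf : Function.Injective R.rho) {y z : Q} (h : y ≠ z) :
    ∃ x, R.act x y ≠ R.act x z := by
  by_contra! hx
  exact h (hf (Equiv.ext hx))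

/-- Inner automorphisms are rack automorphisms. -/
theorem Inn_map_act (R : YBRack Q) {g : Equiv.Perm Q} (hg : g ∈ R.Inn) (x y : Q) :
    g (R.act x y) = R.act (g x) (g y) := by
  induction hg using Subgroup.closure_induction generalizing x y with
  | mem g hg =>
    obtain ⟨z, rfl⟩ := hg
    exact R.self_distrib x y z
  | one => rfl
  | mul g k _ _ ihg ihk => simp [ihg, ihk]
  | inv g _ ih =>
    apply g.injective
    simp [ih]

/-- Over `ℚ`, every 2-cocycle of a finite connected rack is cohomologous to a constant. -/
theorem exists_eq_const_add_coboundary [Finite Q] (R : YBRack Q)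
    (htr : ∀ x y : Q, ∃ g ∈ R.Inn, g x = y) (φ : Q → Q → ℚ)
    (hφ : ∀ x y z, φ (R.act x y) z + φ x y = φ x z + φ (R.act x z) (R.act y z)) :
    ∃ (l : ℚ) (γ : Q → ℚ), ∀ x y, φ x y = l + (γ (R.act x y) - γ x) := by
  classical
  rcases isEmpty_or_nonempty Q with hQ | ⟨⟨o⟩⟩
  · exact ⟨0, fun _ => 0, fun x => hQ.elim x⟩
  have hcob : ∀ g ∈ R.Inn, ∃ γ : Q → ℚ, ∀ x y,
      φ x y = φ (g x) (g y) + (γ (R.act x y) - γ x) := by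
    intro g hg
    induction hg using Subgroup.closure_induction with
    | mem g hg =>
      obtain ⟨z, rfl⟩ := hg
      refine ⟨fun x => - φ x z, fun x y => ?_⟩
      have := hφ x y z
      simp only [rho_apply]
      linarith
    | one => exact ⟨fun _ => 0, fun x y => by simp⟩
    | mul g k hg hk ihg ihk =>
      obtain ⟨a, ha⟩ := ihg
      obtain ⟨b, hb⟩ := ihk
      refine ⟨fun x => a (k x) + b x, fun x y => ?_⟩
      simp only [Equiv.Perm.mul_apply, R.Inn_map_act hk]
      rw [hb x y, ha (k x) (k y)]
      ring
    | inv g hg ih =>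
      obtain ⟨a, ha⟩ := ih
      refine ⟨fun x => - a (g⁻¹ x), fun x y => ?_⟩
      have : φ (g⁻¹ x) (g⁻¹ y) = φ x y + (a (R.act (g⁻¹ x) (g⁻¹ y)) - a (g⁻¹ x)) := by
        simpa using ha (g⁻¹ x) (g⁻¹ y)
      simp only [R.Inn_map_act (inv_mem hg)]
      rw [this]
      ring
  choose! β hβ using hcob
  have : Fintype Q := Fintype.ofFinite Q
  have : Fintype R.Inn := Fintype.ofFinite _
  set N : ℚ := ((Fintype.card R.Inn : ℕ) : ℚ)
  have hN : N ≠ 0 := Nat.cast_ne_zero.mpr Fintype.card_ne_zero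
  let ψ : Q → Q → ℚ := fun x y => ∑ g : R.Inn, φ ((g : Equiv.Perm Q) x) ((g : Equiv.Perm Q) y)
  have hinv : ∀ k ∈ R.Inn, ∀ x y, ψ (k x) (k y) = ψ x y := by
    intro k hk x y
    exact Fintype.sum_equiv (Equiv.mulRight (⟨k, hk⟩ : R.Inn)) _ _ fun g => by simp
  have hψ : ∀ x y z, ψ (R.act x y) z + ψ x y = ψ x z + ψ (R.act x z) (R.act y z) := by
    intro x y z
    simp only [ψ, ← Finset.sum_add_distrib]
    refine Finset.sum_congr rfl fun g _ => ?_
    simp only [R.Inn_map_act g.2]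
    exact hφ _ _ _
  have hleft : ∀ k ∈ R.Inn, ∀ x z, ψ (k x) z = ψ x z := by
    intro k hk
    induction hk using Subgroup.closure_induction with
    | mem k hk =>
      obtain ⟨y, rfl⟩ := hk
      intro x z
      have h1 := hψ x y z
      have h2 := hinv (R.rho z) (Subgroup.subset_closure ⟨z, rfl⟩) x y
      simp only [rho_apply] at h2 ⊢
      linarith
    | one => intro x z; rfl
    | mul g k _ _ ihg ihk => intro x z; simp [ihg, ihk]
    | inv g _ ih => intro x z; rw [← ih]; simp
  have hconst : ∀ x z, ψ x z = ψ o o := by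
    intro x z
    obtain ⟨k, hk, hkx⟩ := htr x o
    obtain ⟨m, hm, hmz⟩ := htr z o
    rw [← hinv m hm, hleft m hm, hmz, ← hleft k hk, hkx]
  refine ⟨ψ o o / N, fun x => (∑ g : R.Inn, β g x) / N, fun x y => ?_⟩
  have key : N * φ x y = ψ x y + ((∑ g : R.Inn, β g (R.act x y)) - ∑ g : R.Inn, β g x) := by
    simp only [ψ, ← Finset.sum_add_distrib, ← Finset.sum_sub_distrib]
    rw [← Finset.sum_congr rfl fun g _ => hβ g.1 g.2 x y]
    simp [N]
  rw [hconst] at key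
  field_simp
  linarith

/-- Infinitesimal rigidity: every Yang–Baxter 2-cocycle with rational coefficients on a finite,
connected rack with behaviourally distinct elements is a coboundary up to a multiple of the
identity. -/
theorem exists_eq_smul_add_coboundary [Finite Q] [DecidableEq Q] (R : YBRack Q)
    (htr : ∀ x y : Q, ∃ g ∈ R.Inn, g x = y) (hf : Function.Injective R.rho)
    (e : Q → Q → Q → Q → ℚ)
    (he : ∀ x y z u v w,
      (if w = z then e x y u v else 0) + (if v = y then e (R.act x y) z (R.act u v) w else 0)
        + (if R.act (R.act u v) w = R.act (R.act x y) z then e y z v w else 0)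
      = (if u = x then e y z v w else 0) + (if R.act v w = R.act y z then e x z u w else 0)
        + (if w = z then e (R.act x z) (R.act y z) (R.act u w) (R.act v w) else 0)) :
    ∃ (l : ℚ) (g : Q → Q → ℚ), ∀ x y u v,
      e x y u v = (if u = x ∧ v = y then l else 0)
        + ((if R.act u v = R.act x y then g y v else 0)
            + (if v = y then g (R.act x y) (R.act u v) else 0))
        - ((if v = y then g x u else 0) + (if u = x then g y v else 0)) := by
  have hoff : ∀ z w, ∃ a : ℚ, z ≠ w → ∀ x u,
      e x z u w = (if R.act u w = R.act x z then a else 0) - (if u = x then a else 0) := by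
    intro z w
    by_cases hzw : z = w
    · exact ⟨0, fun h => (h hzw).elim⟩
    obtain ⟨y, hy⟩ := R.exists_act_ne hf hzw
    refine ⟨- e y z y w, fun _ x' u' => ?_⟩
    obtain ⟨x, rfl⟩ := (R.act_bijective y).surjective x'
    obtain ⟨u, rfl⟩ := (R.act_bijective y).surjective u'
    have := he x y z u y w
    simp only [Ne.symm hzw, Ne.symm hy, if_true, if_false] at this
    simp only [R.act_inj]
    split_ifs at this ⊢ <;> linarith
  choose g₀ hg₀ using hoff
  have hdiag : ∀ y z v, y ≠ v → e y z v z = g₀ (R.act y z) (R.act v z) - g₀ y v := by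
    intro y z v hyv
    obtain ⟨x, hx⟩ := R.exists_act_ne hf hyv
    have h := he x y z x v z
    have hyv' : R.act y z ≠ R.act v z := fun h => hyv ((R.act_inj z).1 h)
    simp only [R.act_inj, ← R.self_distrib, if_true, Ne.symm hyv, Ne.symm hx, if_false,
      hg₀ _ _ hyv, hg₀ _ _ hyv'] at h
    linarith
  obtain ⟨l, γ, hγ⟩ := R.exists_eq_const_add_coboundary htr (fun x y => e x y x y) (by
    intro x y z
    have h := he x y z x y z
    simp only [if_true] at h
    linarith)
  refine ⟨l, fun z w => if z = w then γ z else g₀ z w, fun x y u v => ?_⟩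
  by_cases hv : y = v
  · subst hv
    by_cases hu : x = u
    · subst hu
      simp only [and_self, if_true, hγ x y]
      ring
    · simp [R.act_inj, hu, Ne.symm hu, hdiag x y u hu]
  · simp [hv, Ne.symm hv, hg₀ y v hv]

end YBRack

open scoped Kronecker

section Legs

variable {Q A B : Type*} [DecidableEq Q] [CommRing A] [CommRing B]

/-- The matrix of `f ⊗ id` on triples, for `f` acting on pairs. -/
def leg₁ (M : Matrix (Q × Q) (Q × Q) A) : Matrix ((Q × Q) × Q) ((Q × Q) × Q) A :=
  M ⊗ₖ (1 : Matrix Q Q A)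

/-- The matrix of `id ⊗ f` on triples, for `f` acting on pairs. -/
def leg₂ (M : Matrix (Q × Q) (Q × Q) A) : Matrix ((Q × Q) × Q) ((Q × Q) × Q) A :=
  ((1 : Matrix Q Q A) ⊗ₖ M).submatrix (Equiv.prodAssoc Q Q Q) (Equiv.prodAssoc Q Q Q)

theorem leg₁_apply (M : Matrix (Q × Q) (Q × Q) A) (u v w x y z : Q) :
    leg₁ M ((u, v), w) ((x, y), z) = if w = z then M (u, v) (x, y) else 0 := by
  simp [leg₁, Matrix.one_apply]

theorem leg₂_apply (M : Matrix (Q × Q) (Q × Q) A) (u v w x y z : Q) :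
    leg₂ M ((u, v), w) ((x, y), z) = if u = x then M (v, w) (y, z) else 0 := by
  simp [leg₂, Matrix.one_apply]

theorem leg₁_add (M N : Matrix (Q × Q) (Q × Q) A) : leg₁ (M + N) = leg₁ M + leg₁ N :=
  Matrix.add_kronecker _ _ _

theorem leg₂_add (M N : Matrix (Q × Q) (Q × Q) A) : leg₂ (M + N) = leg₂ M + leg₂ N := by
  simp [leg₂, Matrix.kronecker_add, Matrix.submatrix_add]

theorem leg₁_smul (a : A) (M : Matrix (Q × Q) (Q × Q) A) : leg₁ (a • M) = a • leg₁ M :=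
  Matrix.smul_kronecker _ _ _

theorem leg₂_smul (a : A) (M : Matrix (Q × Q) (Q × Q) A) : leg₂ (a • M) = a • leg₂ M := by
  simp [leg₂, Matrix.kronecker_smul, Matrix.submatrix_smul]

theorem leg₁_map (φ : A →+* B) (M : Matrix (Q × Q) (Q × Q) A) :
    (leg₁ M).map φ = leg₁ (M.map φ) := by
  ext ⟨⟨u, v⟩, w⟩ ⟨⟨x, y⟩, z⟩
  simp [leg₁_apply, apply_ite φ]

theorem leg₂_map (φ : A →+* B) (M : Matrix (Q × Q) (Q × Q) A) :
    (leg₂ M).map φ = leg₂ (M.map φ) := by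
  ext ⟨⟨u, v⟩, w⟩ ⟨⟨x, y⟩, z⟩
  simp [leg₂_apply, apply_ite φ]

variable [Fintype Q]

theorem leg₁_mul (M N : Matrix (Q × Q) (Q × Q) A) : leg₁ (M * N) = leg₁ M * leg₁ N := by
  simp [leg₁, ← Matrix.mul_kronecker_mul]

theorem leg₂_mul (M N : Matrix (Q × Q) (Q × Q) A) : leg₂ (M * N) = leg₂ M * leg₂ N := by
  simp [leg₂, ← Matrix.mul_kronecker_mul, Matrix.submatrix_mul_equiv]

theorem leg₁_mul_kronecker (M : Matrix (Q × Q) (Q × Q) A) (a : Matrix Q Q A) :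
    leg₁ M * ((a ⊗ₖ a) ⊗ₖ a) = (M * (a ⊗ₖ a)) ⊗ₖ a := by
  simp [leg₁, ← Matrix.mul_kronecker_mul]

theorem kronecker_mul_leg₁ (M : Matrix (Q × Q) (Q × Q) A) (a : Matrix Q Q A) :
    ((a ⊗ₖ a) ⊗ₖ a) * leg₁ M = ((a ⊗ₖ a) * M) ⊗ₖ a := by
  simp [leg₁, ← Matrix.mul_kronecker_mul]

omit [DecidableEq Q] [Fintype Q] in
theorem kronecker_kronecker_eq (a b c : Matrix Q Q A) :
    (a ⊗ₖ b) ⊗ₖ c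
      = (a ⊗ₖ (b ⊗ₖ c)).submatrix (Equiv.prodAssoc Q Q Q) (Equiv.prodAssoc Q Q Q) := by
  ext ⟨⟨u, v⟩, w⟩ ⟨⟨x, y⟩, z⟩
  simp [mul_assoc]

theorem leg₂_mul_kronecker (M : Matrix (Q × Q) (Q × Q) A) (a : Matrix Q Q A) :
    leg₂ M * ((a ⊗ₖ a) ⊗ₖ a)
      = (a ⊗ₖ (M * (a ⊗ₖ a))).submatrix (Equiv.prodAssoc Q Q Q) (Equiv.prodAssoc Q Q Q) := by
  simp [leg₂, kronecker_kronecker_eq, Matrix.submatrix_mul_equiv, ← Matrix.mul_kronecker_mul]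

theorem kronecker_mul_leg₂ (M : Matrix (Q × Q) (Q × Q) A) (a : Matrix Q Q A) :
    ((a ⊗ₖ a) ⊗ₖ a) * leg₂ M
      = (a ⊗ₖ ((a ⊗ₖ a) * M)).submatrix (Equiv.prodAssoc Q Q Q) (Equiv.prodAssoc Q Q Q) := by
  simp [leg₂, kronecker_kronecker_eq, Matrix.submatrix_mul_equiv, ← Matrix.mul_kronecker_mul]

/-- The Yang–Baxter equation for matrices indexed by pairs. -/
def MatYBE (M : Matrix (Q × Q) (Q × Q) A) : Prop :=
  leg₁ M * leg₂ M * leg₁ M = leg₂ M * leg₁ M * leg₂ M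

theorem isUnit_kronecker {m n : Type*} [Fintype m] [DecidableEq m] [Fintype n] [DecidableEq n]
    {a : Matrix m m A} {b : Matrix n n A} (ha : IsUnit a) (hb : IsUnit b) : IsUnit (a ⊗ₖ b) := by
  rw [Matrix.isUnit_iff_isUnit_det] at ha hb ⊢
  rw [Matrix.det_kronecker]
  exact (ha.pow _).mul (hb.pow _)

/-- The Yang–Baxter equation is invariant under conjugation by `a ⊗ a`. -/
theorem MatYBE.conj {M N : Matrix (Q × Q) (Q × Q) A} (hM : MatYBE M) {a : Matrix Q Q A}
    (ha : IsUnit a) (h : M * (a ⊗ₖ a) = (a ⊗ₖ a) * N) : MatYBE N := by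
  have h₁ : leg₁ M * ((a ⊗ₖ a) ⊗ₖ a) = ((a ⊗ₖ a) ⊗ₖ a) * leg₁ N := by
    rw [leg₁_mul_kronecker, kronecker_mul_leg₁, h]
  have h₂ : leg₂ M * ((a ⊗ₖ a) ⊗ₖ a) = ((a ⊗ₖ a) ⊗ₖ a) * leg₂ N := by
    rw [leg₂_mul_kronecker, kronecker_mul_leg₂, h]
  have hT : IsUnit ((a ⊗ₖ a) ⊗ₖ a) := isUnit_kronecker (isUnit_kronecker ha ha) ha
  unfold MatYBE at hM ⊢
  refine hT.mul_left_cancel ?_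
  generalize (a ⊗ₖ a) ⊗ₖ a = T at *
  calc T * (leg₁ N * leg₂ N * leg₁ N)
      = T * leg₁ N * leg₂ N * leg₁ N := by simp only [mul_assoc]
    _ = leg₁ M * leg₂ M * leg₁ M * T := by
      rw [← h₁, mul_assoc (leg₁ M), ← h₂, ← mul_assoc, mul_assoc _ T, ← h₁, ← mul_assoc]
    _ = leg₂ M * leg₁ M * leg₂ M * T := by rw [hM]
    _ = T * leg₂ N * leg₁ N * leg₂ N := by
      rw [← h₂, mul_assoc (leg₂ M) T, ← h₁, ← mul_assoc, mul_assoc _ T, ← h₂, ← mul_assoc]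
    _ = T * (leg₂ N * leg₁ N * leg₂ N) := by simp only [mul_assoc]

end Legs

/-- First-order expansion of the braid equation around a solution `C₁`, `C₂`. -/
theorem exists_braid_linearization {A E : Type*} [CommRing A] [Ring E] [Algebra A E] (s t : A)
    (C₁ C₂ E₁ E₂ : E) (hC : C₁ * C₂ * C₁ = C₂ * C₁ * C₂) (ht : ∀ x : E, t • x = 0 → x = 0)
    (h : (s • C₁ + t • E₁) * (s • C₂ + t • E₂) * (s • C₁ + t • E₁)
      = (s • C₂ + t • E₂) * (s • C₁ + t • E₁) * (s • C₂ + t • E₂)) :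
    ∃ K : E, s ^ 2 • ((E₁ * C₂ * C₁ + C₁ * E₂ * C₁ + C₁ * C₂ * E₁)
      - (E₂ * C₁ * C₂ + C₂ * E₁ * C₂ + C₂ * C₁ * E₂)) + t • K = 0 := by
  refine ⟨s • ((E₁ * E₂ * C₁ + E₁ * C₂ * E₁ + C₁ * E₂ * E₁)
      - (E₂ * E₁ * C₂ + E₂ * C₁ * E₂ + C₂ * E₁ * E₂))
      + t • (E₁ * E₂ * E₁ - E₂ * E₁ * E₂), ht _ ?_⟩
  have h' := sub_eq_zero.2 h
  have hC' : s ^ 3 • (C₁ * C₂ * C₁ - C₂ * C₁ * C₂) = 0 := by rw [hC, sub_self, smul_zero]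
  rw [← sub_zero (t • _), ← sub_self (0 : E)]
  nth_rewrite 1 [← h']
  rw [← hC']
  simp only [mul_add, add_mul, smul_mul_assoc, mul_smul_comm]
  module

namespace YBRack

variable {Q : Type*} (R : YBRack Q)

/-- The permutation `(x, y) ↦ (y, x ^ y)` of `Q × Q`. -/
def braidPerm : Equiv.Perm (Q × Q) where
  toFun p := (p.2, R.act p.1 p.2)
  invFun p := ((R.rho p.1).symm p.2, p.1)
  left_inv p := by
    ext
    · exact (R.rho p.2).symm_apply_apply p.1
    · rfl
  right_inv p := by
    ext
    · rfl
    · exact (R.rho p.1).apply_symm_apply p.2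

@[simp]
theorem braidPerm_apply (x y : Q) : R.braidPerm (x, y) = (y, R.act x y) := rfl

/-- `braidPerm` acting on the first two entries of a triple. -/
def braidPerm₁ : Equiv.Perm ((Q × Q) × Q) := R.braidPerm.prodCongr (Equiv.refl Q)

/-- `braidPerm` acting on the last two entries of a triple. -/
def braidPerm₂ : Equiv.Perm ((Q × Q) × Q) :=
  (Equiv.prodAssoc Q Q Q).trans
    (((Equiv.refl Q).prodCongr R.braidPerm).trans (Equiv.prodAssoc Q Q Q).symm)

@[simp]
theorem braidPerm₁_apply (x y z : Q) : R.braidPerm₁ ((x, y), z) = ((y, R.act x y), z) := rfl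

@[simp]
theorem braidPerm₂_apply (x y z : Q) : R.braidPerm₂ ((x, y), z) = ((x, z), R.act y z) := rfl

end YBRack

section PermMatrix

variable {n A : Type*} [DecidableEq n] [CommRing A]

/-- The matrix of the linear map sending the basis vector `i` to the basis vector `σ i`. -/
def permMat (A : Type*) [CommRing A] (σ : Equiv.Perm n) : Matrix n n A :=
  (1 : Matrix n n A).submatrix id σ

theorem permMat_apply (σ : Equiv.Perm n) (i j : n) :
    permMat A σ i j = if i = σ j then 1 else 0 := by
  simp [permMat, Matrix.one_apply]

theorem permMat_map {B : Type*} [CommRing B] (φ : A →+* B) (σ : Equiv.Perm n) :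
    (permMat A σ).map φ = permMat B σ := by
  ext i j
  simp [permMat_apply, apply_ite φ]

variable [Fintype n]

theorem mul_permMat (σ : Equiv.Perm n) (M : Matrix n n A) :
    M * permMat A σ = M.submatrix id σ := by
  ext i j
  simp [permMat_apply, Matrix.mul_apply]

theorem permMat_mul_permMat (σ τ : Equiv.Perm n) :
    permMat A σ * permMat A τ = permMat A (σ * τ) := by
  rw [mul_permMat]
  rfl

theorem permMat_mul_submatrix (σ : Equiv.Perm n) (M : Matrix n n A) :
    permMat A σ * M.submatrix σ σ = M * permMat A σ := by
  rw [mul_permMat]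
  ext i j
  obtain ⟨i, rfl⟩ := σ.surjective i
  simp [permMat_apply, Matrix.mul_apply]

theorem isUnit_permMat (σ : Equiv.Perm n) : IsUnit (permMat A σ) :=
  ⟨⟨permMat A σ, permMat A σ⁻¹, by rw [permMat_mul_permMat]; simp [permMat],
    by rw [permMat_mul_permMat]; simp [permMat]⟩, rfl⟩

end PermMatrix

namespace YBRack

variable {Q A : Type*} [DecidableEq Q] [CommRing A] (R : YBRack Q)

theorem leg₁_permMat : leg₁ (permMat A R.braidPerm) = permMat A R.braidPerm₁ := by
  ext ⟨⟨u, v⟩, w⟩ ⟨⟨x, y⟩, z⟩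
  rw [leg₁_apply, permMat_apply, permMat_apply, braidPerm₁_apply, braidPerm_apply]
  simp only [Prod.mk.injEq]
  split_ifs <;> simp_all

theorem leg₂_permMat : leg₂ (permMat A R.braidPerm) = permMat A R.braidPerm₂ := by
  ext ⟨⟨u, v⟩, w⟩ ⟨⟨x, y⟩, z⟩
  rw [leg₂_apply, permMat_apply, permMat_apply, braidPerm₂_apply, braidPerm_apply]
  simp only [Prod.mk.injEq]
  split_ifs <;> simp_all

variable [Fintype Q]

theorem matYBE_permMat : MatYBE (permMat A R.braidPerm) := by
  unfold MatYBE
  rw [leg₁_permMat, leg₂_permMat]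
  simp only [permMat_mul_permMat]
  congr 1
  refine Equiv.ext fun ⟨⟨x, y⟩, z⟩ => ?_
  simp only [Equiv.Perm.mul_apply, braidPerm₁_apply, braidPerm₂_apply, ← R.self_distrib]

/-- The linearised Yang–Baxter equation, written entrywise. -/
theorem cocycle_of_linearized (f : Matrix (Q × Q) (Q × Q) A)
    (h : let C₁ := leg₁ (permMat A R.braidPerm)
      let C₂ := leg₂ (permMat A R.braidPerm)
      let E₁ := leg₁ (permMat A R.braidPerm * f)
      let E₂ := leg₂ (permMat A R.braidPerm * f)
      E₁ * C₂ * C₁ + C₁ * E₂ * C₁ + C₁ * C₂ * E₁ = E₂ * C₁ * C₂ + C₂ * E₁ * C₂ + C₂ * C₁ * E₂)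
    (x y z u v w : Q) :
    (if w = z then f (u, v) (x, y) else 0)
        + (if v = y then f (R.act u v, w) (R.act x y, z) else 0)
        + (if R.act (R.act u v) w = R.act (R.act x y) z then f (v, w) (y, z) else 0)
      = (if u = x then f (v, w) (y, z) else 0)
        + (if R.act v w = R.act y z then f (u, w) (x, z) else 0)
        + (if w = z then f (R.act u w, R.act v w) (R.act x z, R.act y z) else 0) := by
  have hb : leg₁ (permMat A R.braidPerm) * leg₂ (permMat A R.braidPerm)
      * leg₁ (permMat A R.braidPerm) = leg₂ (permMat A R.braidPerm)
      * leg₁ (permMat A R.braidPerm) * leg₂ (permMat A R.braidPerm) := R.matYBE_permMat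
  simp only [leg₁_mul, leg₂_mul] at h
  rw [leg₁_permMat, leg₂_permMat] at h hb
  set C₁ := permMat A R.braidPerm₁
  set C₂ := permMat A R.braidPerm₂
  have p₁ : ∀ M, M * C₁ = C₁ * M.submatrix R.braidPerm₁ R.braidPerm₁ := fun M =>
    (permMat_mul_submatrix _ _).symm
  have p₂ : ∀ M, M * C₂ = C₂ * M.submatrix R.braidPerm₂ R.braidPerm₂ := fun M =>
    (permMat_mul_submatrix _ _).symm
  have hU : IsUnit (C₁ * C₂ * C₁) :=
    ((isUnit_permMat _).mul (isUnit_permMat _)).mul (isUnit_permMat _)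
  have key : leg₁ f + (leg₂ f).submatrix R.braidPerm₁ R.braidPerm₁
      + ((leg₁ f).submatrix R.braidPerm₂ R.braidPerm₂).submatrix R.braidPerm₁ R.braidPerm₁
      = leg₂ f + (leg₁ f).submatrix R.braidPerm₂ R.braidPerm₂
      + ((leg₂ f).submatrix R.braidPerm₁ R.braidPerm₁).submatrix R.braidPerm₂ R.braidPerm₂ := by
    refine hU.mul_left_cancel ?_
    have e₁ : C₁ * leg₁ f * C₂ * C₁ = C₁ * C₂ * C₁ *
        ((leg₁ f).submatrix R.braidPerm₂ R.braidPerm₂).submatrix R.braidPerm₁ R.braidPerm₁ := by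
      rw [mul_assoc C₁, p₂, ← mul_assoc, mul_assoc _ _ C₁, p₁, ← mul_assoc]
    have e₂ : C₁ * (C₂ * leg₂ f) * C₁ = C₁ * C₂ * C₁ *
        (leg₂ f).submatrix R.braidPerm₁ R.braidPerm₁ := by
      rw [← mul_assoc, mul_assoc _ _ C₁, p₁, ← mul_assoc]
    have e₃ : C₂ * leg₂ f * C₁ * C₂ = C₁ * C₂ * C₁ *
        ((leg₂ f).submatrix R.braidPerm₁ R.braidPerm₁).submatrix R.braidPerm₂ R.braidPerm₂ := by
      rw [hb, mul_assoc C₂, p₁, ← mul_assoc, mul_assoc _ _ C₂, p₂, ← mul_assoc]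
    have e₄ : C₂ * (C₁ * leg₁ f) * C₂ = C₁ * C₂ * C₁ *
        (leg₁ f).submatrix R.braidPerm₂ R.braidPerm₂ := by
      rw [hb, ← mul_assoc, mul_assoc _ _ C₂, p₂, ← mul_assoc]
    have e₅ : C₂ * C₁ * (C₂ * leg₂ f) = C₁ * C₂ * C₁ * leg₂ f := by
      rw [hb, ← mul_assoc]
    have e₆ : C₁ * C₂ * (C₁ * leg₁ f) = C₁ * C₂ * C₁ * leg₁ f := by
      rw [← mul_assoc]
    rw [e₁, e₂, e₃, e₄, e₅, e₆] at h
    simp only [mul_add]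
    exact Eq.trans (by abel) (h.trans (by abel))
  have := congrFun (congrFun key ((u, v), w)) ((x, y), z)
  simp only [Matrix.add_apply, Matrix.submatrix_apply, braidPerm₁_apply, braidPerm₂_apply,
    leg₁_apply, leg₂_apply] at this
  exact this

end YBRack

section PowerSeriesMatrix

open PowerSeries

variable {m n : Type*}

theorem exists_eq_X_smul_of_map_eq_zero (B : Matrix m n (PowerSeries ℚ))
    (h : B.map (constantCoeff (R := ℚ)) = 0) :
    ∃ B' : Matrix m n (PowerSeries ℚ), B = (X : PowerSeries ℚ) • B' := by
  have : ∀ i j, ∃ b, B i j = X * b := fun i j => X_dvd_iff.2 (congrFun (congrFun h i) j)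
  choose B' hB' using this
  exact ⟨Matrix.of B', by ext1 i j; simpa using hB' i j⟩

theorem isUnit_of_map_constantCoeff_eq_one [Fintype n] [DecidableEq n]
    {a : Matrix n n (PowerSeries ℚ)} (h : a.map (constantCoeff (R := ℚ)) = 1) : IsUnit a := by
  rw [Matrix.isUnit_iff_isUnit_det, isUnit_iff_constantCoeff, RingHom.map_det,
    RingHom.mapMatrix_apply, h, Matrix.det_one]
  exact isUnit_one

/-- `X`-adic completeness of the ring of power series. -/
theorem exists_X_adic_limit (u : ℕ → PowerSeries ℚ)
    (hu : ∀ n, (X : PowerSeries ℚ) ^ (n + 1) ∣ u (n + 1) - u n) :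
    ∃ L : PowerSeries ℚ, ∀ n, (X : PowerSeries ℚ) ^ (n + 1) ∣ L - u n := by
  have hcoeff : ∀ n k i, i < n + 1 → coeff i (u (n + k)) = coeff i (u n) := by
    intro n k i hi
    induction k with
    | zero => rfl
    | succ k ih =>
      have := X_pow_dvd_iff.1 (hu (n + k)) i (by omega)
      rw [map_sub, sub_eq_zero] at this
      rw [← ih, ← this, add_assoc]
  refine ⟨PowerSeries.mk fun i => coeff i (u i), fun n => X_pow_dvd_iff.2 fun i hi => ?_⟩
  obtain ⟨k, rfl⟩ := Nat.exists_eq_add_of_le (Nat.lt_succ_iff.1 hi)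
  rw [map_sub, coeff_mk, hcoeff i k i (by omega), sub_self]

end PowerSeriesMatrix

namespace YBRack

open PowerSeries

variable {Q : Type*} [DecidableEq Q] [Fintype Q] (R : YBRack Q)

/-- The action of an endomorphism `g` of `AQ` as a derivation on `AQ ⊗ AQ`. -/
def leibniz {A : Type*} [CommRing A] (g : Matrix Q Q A) : Matrix (Q × Q) (Q × Q) A :=
  g ⊗ₖ (1 : Matrix Q Q A) + (1 : Matrix Q Q A) ⊗ₖ g

omit [Fintype Q] in
theorem leibniz_map {A B : Type*} [CommRing A] [CommRing B] (φ : A →+* B) (g : Matrix Q Q A) :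
    (leibniz g).map φ = leibniz (g.map φ) := by
  ext ⟨u, v⟩ ⟨x, y⟩
  simp [leibniz, Matrix.one_apply, apply_ite φ]

theorem exists_gauge_of_linearized
    (htr : ∀ x y : Q, ∃ g ∈ R.Inn, g x = y) (hf : Function.Injective R.rho)
    (f : Matrix (Q × Q) (Q × Q) ℚ)
    (h : let C₁ := leg₁ (permMat ℚ R.braidPerm)
      let C₂ := leg₂ (permMat ℚ R.braidPerm)
      let E₁ := leg₁ (permMat ℚ R.braidPerm * f)
      let E₂ := leg₂ (permMat ℚ R.braidPerm * f)
      E₁ * C₂ * C₁ + C₁ * E₂ * C₁ + C₁ * C₂ * E₁ = E₂ * C₁ * C₂ + C₂ * E₁ * C₂ + C₂ * C₁ * E₂) :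
    ∃ (l : ℚ) (g : Matrix Q Q ℚ), permMat ℚ R.braidPerm * f
      + (permMat ℚ R.braidPerm * leibniz g - leibniz g * permMat ℚ R.braidPerm)
      - l • permMat ℚ R.braidPerm = 0 := by
  obtain ⟨l, g, hg⟩ := R.exists_eq_smul_add_coboundary htr hf
    (fun x y u v => f (u, v) (x, y)) (R.cocycle_of_linearized f h)
  refine ⟨l, Matrix.of fun u x => g x u, ?_⟩
  set G := leibniz (Matrix.of fun u x => g x u)
  have hfG : f = l • (1 : Matrix (Q × Q) (Q × Q) ℚ)
      + G.submatrix R.braidPerm R.braidPerm - G := by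
    ext ⟨u, v⟩ ⟨x, y⟩
    rw [hg x y u v]
    simp only [G, leibniz, Matrix.add_apply, Matrix.sub_apply, Matrix.smul_apply,
      Matrix.submatrix_apply, braidPerm_apply, Matrix.kronecker_apply, Matrix.one_apply,
      Matrix.of_apply, Prod.mk.injEq, smul_eq_mul, mul_ite, ite_mul, mul_one, one_mul, mul_zero,
      zero_mul]
  rw [← permMat_mul_submatrix, hfG]
  simp only [mul_add, mul_sub, mul_smul_comm, mul_one]
  abel

theorem add_smul_mul_kronecker_self {A : Type*} [CommRing A] (a g : Matrix Q Q A) (t : A) :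
    (a + t • (a * g)) ⊗ₖ (a + t • (a * g))
      = (a ⊗ₖ a) * (1 + t • leibniz g + (t * t) • (g ⊗ₖ g)) := by
  have h₀ : a + t • (a * g) = a * (1 + t • g) := by
    rw [mul_add, mul_one, mul_smul_comm]
  rw [h₀, Matrix.mul_kronecker_mul, leibniz]
  congr 1
  simp only [Matrix.add_kronecker, Matrix.kronecker_add, Matrix.smul_kronecker,
    Matrix.kronecker_smul, Matrix.one_kronecker_one]
  module

theorem gauge_expansion {A E : Type*} [CommRing A] [Ring E] [Algebra A E] (s t l : A)
    {M T C f : E} (G H : E) (h : M * T = T * (s • C + t • (C * f))) :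
    M * (T * (1 + t • G + (t * t) • H)) - (s + t * l) • (T * (1 + t • G + (t * t) • H) * C)
      = t • (T * (C * f + s • (C * G - G * C) - l • C
        + t • (s • (C * H - H * C) + C * f * G - l • (G * C)
          + t • (C * f * H - l • (H * C))))) := by
  rw [← mul_assoc, h]
  simp only [mul_assoc, mul_add, add_mul, mul_sub, mul_one, smul_mul_assoc,
    mul_smul_comm]
  module

theorem mapMatrix_constantCoeff_smul {k : Type*} [Fintype k] [DecidableEq k] (c : PowerSeries ℚ)
    (B : Matrix k k (PowerSeries ℚ)) :
    (constantCoeff (R := ℚ)).mapMatrix (c • B)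
      = constantCoeff c • (constantCoeff (R := ℚ)).mapMatrix B := by
  ext i j
  simp

/-- Improving a gauge equivalence from order `n` to order `n + 1`. -/
theorem exists_gauge_step
    (htr : ∀ x y : Q, ∃ g ∈ R.Inn, g x = y) (hf : Function.Injective R.rho)
    {M : Matrix (Q × Q) (Q × Q) (PowerSeries ℚ)} (hM : MatYBE M) {n : ℕ} (hn : n ≠ 0)
    {a : Matrix Q Q (PowerSeries ℚ)} {s : PowerSeries ℚ}
    (ha : a.map (constantCoeff (R := ℚ)) = 1) (hs : constantCoeff s = 1)
    {E : Matrix (Q × Q) (Q × Q) (PowerSeries ℚ)}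
    (hE : M * (a ⊗ₖ a) - s • ((a ⊗ₖ a) * permMat _ R.braidPerm) = (X : PowerSeries ℚ) ^ n • E) :
    ∃ (b : Matrix Q Q (PowerSeries ℚ)) (r : PowerSeries ℚ)
      (E' : Matrix (Q × Q) (Q × Q) (PowerSeries ℚ)),
      M * ((a + (X : PowerSeries ℚ) ^ n • b) ⊗ₖ (a + (X : PowerSeries ℚ) ^ n • b))
        - (s + X ^ n * r) • (((a + (X : PowerSeries ℚ) ^ n • b)
          ⊗ₖ (a + (X : PowerSeries ℚ) ^ n • b)) * permMat _ R.braidPerm)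
        = (X : PowerSeries ℚ) ^ (n + 1) • E' := by
  set t : PowerSeries ℚ := X ^ n with ht_def
  have ht : constantCoeff t = 0 := by simp [ht_def, hn]
  have ht0 : t ≠ 0 := pow_ne_zero _ X_ne_zero
  set C : Matrix (Q × Q) (Q × Q) (PowerSeries ℚ) := permMat _ R.braidPerm with hC_def
  have hCmap : C.map (constantCoeff (R := ℚ)) = permMat ℚ R.braidPerm := permMat_map _ _
  have hau := isUnit_of_map_constantCoeff_eq_one ha
  have hKC : IsUnit ((a ⊗ₖ a) * C) := (isUnit_kronecker hau hau).mul (isUnit_permMat _)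
  obtain ⟨f, hfE⟩ : ∃ f, (a ⊗ₖ a) * (C * f) = E := by
    obtain ⟨U, hU⟩ := hKC
    refine ⟨U⁻¹.val * E, ?_⟩
    rw [← mul_assoc, ← hU, ← mul_assoc, U.mul_inv, one_mul]
  have hMK : M * (a ⊗ₖ a) = (a ⊗ₖ a) * (s • C + t • (C * f)) := by
    rw [mul_add, mul_smul_comm, mul_smul_comm, hfE, ← hE]
    abel
  have hN := hM.conj hau hMK
  unfold MatYBE at hN
  simp only [leg₁_add, leg₂_add, leg₁_smul, leg₂_smul] at hN
  have hCb : leg₁ C * leg₂ C * leg₁ C = leg₂ C * leg₁ C * leg₂ C := R.matYBE_permMat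
  obtain ⟨K, hK⟩ := exists_braid_linearization s t (leg₁ C) (leg₂ C) (leg₁ (C * f))
    (leg₂ (C * f)) hCb (fun x hx => (smul_eq_zero.1 hx).resolve_left ht0) hN
  have hlin := congrArg (constantCoeff (R := ℚ)).mapMatrix hK
  rw [map_add, mapMatrix_constantCoeff_smul, mapMatrix_constantCoeff_smul, map_pow, ht, hs,
    one_pow, one_smul, zero_smul, add_zero, map_zero] at hlin
  simp only [map_add, map_sub, map_mul] at hlin
  simp only [RingHom.mapMatrix_apply, leg₁_map, leg₂_map, Matrix.map_mul, hCmap] at hlin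
  obtain ⟨l, g, hlg⟩ := R.exists_gauge_of_linearized htr hf (f.map (constantCoeff (R := ℚ)))
    (sub_eq_zero.1 hlin)
  set g' : Matrix Q Q (PowerSeries ℚ) := g.map (PowerSeries.C (R := ℚ)) with hg'_def
  have hg' : g'.map (constantCoeff (R := ℚ)) = g := by
    ext i j
    simp [hg'_def]
  set G := leibniz g' with hG_def
  have hG : G.map (constantCoeff (R := ℚ)) = leibniz g := by rw [hG_def, leibniz_map, hg']
  set l' : PowerSeries ℚ := PowerSeries.C l with hl'_def
  have hl' : constantCoeff l' = l := by simp [hl'_def]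
  set H := g' ⊗ₖ g' with hH_def
  obtain ⟨B, hB⟩ := exists_eq_X_smul_of_map_eq_zero
    (C * f + s • (C * G - G * C) - l' • C
      + t • (s • (C * H - H * C) + C * f * G - l' • (G * C) + t • (C * f * H - l' • (H * C)))) (by
    rw [← RingHom.mapMatrix_apply]
    simp only [mapMatrix_constantCoeff_smul, map_add, map_sub, map_mul, ht, hs, hl', one_smul, zero_smul, add_zero]
    simp only [RingHom.mapMatrix_apply, hCmap, hG]
    exact hlg)
  refine ⟨a * g', l', (a ⊗ₖ a) * B, ?_⟩
  rw [add_smul_mul_kronecker_self, gauge_expansion s t l' (leibniz g') (g' ⊗ₖ g') hMK, hB,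
    mul_smul_comm, smul_smul, pow_succ]

theorem exists_kronecker_add_smul {A : Type*} [CommRing A]
    (M C : Matrix (Q × Q) (Q × Q) A) (a b : Matrix Q Q A) (s t r : A)
    {E : Matrix (Q × Q) (Q × Q) A} (hE : M * (a ⊗ₖ a) - s • ((a ⊗ₖ a) * C) = t • E) :
    ∃ E', M * ((a + t • b) ⊗ₖ (a + t • b))
      - (s + t * r) • (((a + t • b) ⊗ₖ (a + t • b)) * C) = t • E' := by
  obtain ⟨H, hH⟩ : ∃ H, (a + t • b) ⊗ₖ (a + t • b) = a ⊗ₖ a + t • H := by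
    refine ⟨a ⊗ₖ b + b ⊗ₖ a + t • b ⊗ₖ b, ?_⟩
    simp only [Matrix.add_kronecker, Matrix.kronecker_add, Matrix.smul_kronecker,
      Matrix.kronecker_smul]
    module
  refine ⟨E + M * H - s • (H * C) - r • ((a ⊗ₖ a) * C + t • (H * C)), ?_⟩
  rw [hH, sub_eq_iff_eq_add.1 hE |> fun h => (mul_add M _ _).trans (by rw [h])]
  simp only [add_mul, mul_smul_comm, smul_mul_assoc]
  module

/-- Rigidity in matrix form. -/
theorem exists_gauge
    (htr : ∀ x y : Q, ∃ g ∈ R.Inn, g x = y) (hf : Function.Injective R.rho)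
    {M : Matrix (Q × Q) (Q × Q) (PowerSeries ℚ)} (hM : MatYBE M)
    (hM₀ : M.map (constantCoeff (R := ℚ)) = permMat ℚ R.braidPerm) :
    ∃ (a : Matrix Q Q (PowerSeries ℚ)) (s : PowerSeries ℚ),
      a.map (constantCoeff (R := ℚ)) = 1 ∧ constantCoeff s = 1 ∧
      M * (a ⊗ₖ a) = s • ((a ⊗ₖ a) * permMat _ R.braidPerm) := by
  let D : Matrix Q Q (PowerSeries ℚ) × PowerSeries ℚ → Matrix (Q × Q) (Q × Q) (PowerSeries ℚ) :=
    fun p => M * (p.1 ⊗ₖ p.1) - p.2 • ((p.1 ⊗ₖ p.1) * permMat _ R.braidPerm)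
  let P : ℕ → Matrix Q Q (PowerSeries ℚ) × PowerSeries ℚ → Prop := fun n p =>
    p.1.map (constantCoeff (R := ℚ)) = 1 ∧ constantCoeff p.2 = 1 ∧
      ∃ E, D p = (X : PowerSeries ℚ) ^ (n + 1) • E
  have hstep : ∀ n p, P n p → ∃ q, P (n + 1) q ∧
      (∃ b, q.1 = p.1 + (X : PowerSeries ℚ) ^ (n + 1) • b) ∧
      ∃ r, q.2 = p.2 + X ^ (n + 1) * r := by
    rintro n ⟨a, s⟩ ⟨ha, hs, E, hE⟩
    obtain ⟨b, r, E', hE'⟩ := R.exists_gauge_step htr hf hM n.succ_ne_zero ha hs hE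
    refine ⟨(a + (X : PowerSeries ℚ) ^ (n + 1) • b, s + X ^ (n + 1) * r),
      ⟨?_, ?_, E', hE'⟩, ⟨b, rfl⟩, ⟨r, rfl⟩⟩
    · rw [← ha]
      ext i j
      simp
    · simpa using hs
  have hbase : P 0 (1, 1) := by
    refine ⟨Matrix.map_one _ (map_zero _) (map_one _), map_one _, ?_⟩
    obtain ⟨E, hE⟩ := exists_eq_X_smul_of_map_eq_zero (D (1, 1)) (by
      have : (permMat (PowerSeries ℚ) R.braidPerm).map (constantCoeff (R := ℚ))
        = permMat ℚ R.braidPerm := permMat_map _ _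
      ext i j
      have h₁ := congrFun (congrFun hM₀ i) j
      have h₂ := congrFun (congrFun this i) j
      simp only [Matrix.map_apply] at h₁ h₂
      simp [D, h₁, h₂])
    exact ⟨E, by rw [hE, zero_add, pow_one]⟩
  choose! next hnext using hstep
  let p : ℕ → Matrix Q Q (PowerSeries ℚ) × PowerSeries ℚ := fun n => Nat.rec (1, 1) next n
  have hp : ∀ n, P n (p n) := fun n => by
    induction n with
    | zero => exact hbase
    | succ n ih => exact (hnext n _ ih).1
  have hpa : ∀ i j, ∃ L, ∀ n, (X : PowerSeries ℚ) ^ (n + 1) ∣ L - (p n).1 i j := fun i j =>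
    exists_X_adic_limit _ fun n => by
      obtain ⟨b, hb⟩ := (hnext n _ (hp n)).2.1
      have hb' : (p (n + 1)).1 = (p n).1 + (X : PowerSeries ℚ) ^ (n + 1) • b := hb
      exact ⟨b i j, by simp [hb']⟩
  have hps : ∃ L, ∀ n, (X : PowerSeries ℚ) ^ (n + 1) ∣ L - (p n).2 :=
    exists_X_adic_limit _ fun n => by
      obtain ⟨r, hr⟩ := (hnext n _ (hp n)).2.2
      have hr' : (p (n + 1)).2 = (p n).2 + X ^ (n + 1) * r := hr
      exact ⟨r, by simp [hr']⟩
  choose a ha using hpa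
  obtain ⟨s, hs⟩ := hps
  refine ⟨Matrix.of a, s, ?_, ?_, sub_eq_zero.1 ?_⟩
  · ext i j
    have := X_dvd_iff.1 ((pow_one (X : PowerSeries ℚ)) ▸ ha i j 0)
    rw [← (hp 0).1]
    simpa [sub_eq_zero] using this
  · have := X_dvd_iff.1 ((pow_one (X : PowerSeries ℚ)) ▸ hs 0)
    rw [← (hp 0).2.1]
    simpa [sub_eq_zero] using this
  · ext i j k
    obtain ⟨r, hr⟩ := hs k
    choose b hb using fun i j => ha i j k
    obtain ⟨E, hE⟩ := (hp k).2.2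
    obtain ⟨E', hE'⟩ := exists_kronecker_add_smul M _ (p k).1 (Matrix.of b) (p k).2 _ r hE
    have h₁ : (p k).1 + (X : PowerSeries ℚ) ^ (k + 1) • Matrix.of b = Matrix.of a := by
      ext1 i j
      simp [← hb]
    have h₂ : (p k).2 + X ^ (k + 1) * r = s := by simp [← hr]
    rw [h₁, h₂] at hE'
    rw [hE']
    exact X_pow_dvd_iff.1 (Dvd.intro _ rfl) k (Nat.lt_succ_self k)

end YBRack


section MatrixOfEndomorphism

variable {Q A : Type*} [DecidableEq Q] [Fintype Q] [CommRing A]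

/-- The standard basis of `AQ ⊗ AQ`. -/
def stdBasis₂ (Q A : Type*) [CommRing A] :
    Module.Basis (Q × Q) A ((Q →₀ A) ⊗[A] (Q →₀ A)) :=
  Module.Basis.tensorProduct Finsupp.basisSingleOne Finsupp.basisSingleOne

/-- The standard basis of `(AQ ⊗ AQ) ⊗ AQ`. -/
def stdBasis₃ (Q A : Type*) [CommRing A] :
    Module.Basis ((Q × Q) × Q) A (((Q →₀ A) ⊗[A] (Q →₀ A)) ⊗[A] (Q →₀ A)) :=
  Module.Basis.tensorProduct (stdBasis₂ Q A) Finsupp.basisSingleOne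

omit [DecidableEq Q] [Fintype Q] in
theorem stdBasis₂_apply (p : Q × Q) :
    stdBasis₂ Q A p = Finsupp.single p.1 1 ⊗ₜ Finsupp.single p.2 1 := by
  simp [stdBasis₂, Module.Basis.tensorProduct_apply']

omit [DecidableEq Q] [Fintype Q] in
theorem finsuppTensorFinsupp'_eq_repr (z : (Q →₀ A) ⊗[A] (Q →₀ A)) :
    finsuppTensorFinsupp' A Q Q z = (stdBasis₂ Q A).repr z := by
  refine LinearMap.congr_fun (f := (finsuppTensorFinsupp' A Q Q).toLinearMap)
    (g := (stdBasis₂ Q A).repr.toLinearMap) ((stdBasis₂ Q A).ext fun p => ?_) z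
  simp [stdBasis₂_apply, finsuppTensorFinsupp'_single_tmul_single]
  rw [← stdBasis₂_apply, Module.Basis.repr_self]

theorem toMatrix_stdBasis₂_apply
    (f : ((Q →₀ A) ⊗[A] (Q →₀ A)) →ₗ[A] ((Q →₀ A) ⊗[A] (Q →₀ A))) (p q : Q × Q) :
    LinearMap.toMatrix (stdBasis₂ Q A) (stdBasis₂ Q A) f q p = mat2 A f p q := by
  rw [LinearMap.toMatrix_apply, mat2, finsuppTensorFinsupp'_eq_repr,
    finsuppTensorFinsupp'_symm_single_eq_single_one_tmul, stdBasis₂_apply]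

theorem toMatrix_rTensor (f : ((Q →₀ A) ⊗[A] (Q →₀ A)) →ₗ[A] ((Q →₀ A) ⊗[A] (Q →₀ A))) :
    LinearMap.toMatrix (stdBasis₃ Q A) (stdBasis₃ Q A) (LinearMap.rTensor (Q →₀ A) f)
      = leg₁ (LinearMap.toMatrix (stdBasis₂ Q A) (stdBasis₂ Q A) f) := by
  ext ⟨p, w⟩ ⟨q, z⟩
  rw [LinearMap.toMatrix_apply, stdBasis₃, Module.Basis.tensorProduct_apply,
    LinearMap.rTensor_tmul, Module.Basis.tensorProduct_repr_tmul_apply, leg₁_apply,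
    LinearMap.toMatrix_apply]
  simp [Finsupp.single_apply, eq_comm]

theorem toMatrix_lTensor (f : ((Q →₀ A) ⊗[A] (Q →₀ A)) →ₗ[A] ((Q →₀ A) ⊗[A] (Q →₀ A))) :
    LinearMap.toMatrix (stdBasis₃ Q A) (stdBasis₃ Q A)
        ((TensorProduct.assoc A (Q →₀ A) (Q →₀ A) (Q →₀ A)).symm.toLinearMap ∘ₗ
          LinearMap.lTensor (Q →₀ A) f ∘ₗ
          (TensorProduct.assoc A (Q →₀ A) (Q →₀ A) (Q →₀ A)).toLinearMap)
      = leg₂ (LinearMap.toMatrix (stdBasis₂ Q A) (stdBasis₂ Q A) f) := by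
  set b : Module.Basis Q A (Q →₀ A) := Finsupp.basisSingleOne
  have hassoc : ∀ i, TensorProduct.assoc A (Q →₀ A) (Q →₀ A) (Q →₀ A) (stdBasis₃ Q A i)
      = b.tensorProduct (stdBasis₂ Q A) (Equiv.prodAssoc Q Q Q i) := by
    rintro ⟨⟨x, y⟩, z⟩
    simp [stdBasis₃, stdBasis₂_apply, b]
  have hrepr : ∀ w i, (stdBasis₃ Q A).repr
      ((TensorProduct.assoc A (Q →₀ A) (Q →₀ A) (Q →₀ A)).symm w) i
      = (b.tensorProduct (stdBasis₂ Q A)).repr w (Equiv.prodAssoc Q Q Q i) := by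
    intro w i
    obtain ⟨w, rfl⟩ := (TensorProduct.assoc A (Q →₀ A) (Q →₀ A) (Q →₀ A)).surjective w
    rw [LinearEquiv.symm_apply_apply]
    refine LinearMap.congr_fun
      (f := (Finsupp.lapply i).comp (stdBasis₃ Q A).repr.toLinearMap)
      (g := (Finsupp.lapply (Equiv.prodAssoc Q Q Q i)).comp
        ((b.tensorProduct (stdBasis₂ Q A)).repr.toLinearMap.comp
          (TensorProduct.assoc A (Q →₀ A) (Q →₀ A) (Q →₀ A)).toLinearMap))
      ((stdBasis₃ Q A).ext fun j => ?_) w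
    simp only [LinearMap.comp_apply, LinearEquiv.coe_coe, Finsupp.lapply_apply, hassoc,
      Module.Basis.repr_self, Finsupp.single_apply, (Equiv.prodAssoc Q Q Q).injective.eq_iff]
  ext ⟨⟨u, v⟩, w⟩ ⟨⟨x, y⟩, z⟩
  rw [LinearMap.toMatrix_apply, leg₂_apply, LinearMap.toMatrix_apply]
  simp only [LinearMap.comp_apply, LinearEquiv.coe_coe]
  rw [hrepr, hassoc]
  simp [Module.Basis.tensorProduct_apply', Module.Basis.tensorProduct_repr_tmul_apply, b,
    Finsupp.single_apply, eq_comm]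

theorem YBE.matYBE {f : ((Q →₀ A) ⊗[A] (Q →₀ A)) →ₗ[A] ((Q →₀ A) ⊗[A] (Q →₀ A))}
    (hf : YBE f) : MatYBE (LinearMap.toMatrix (stdBasis₂ Q A) (stdBasis₂ Q A) f) := by
  have h := congrArg (LinearMap.toMatrix (stdBasis₃ Q A) (stdBasis₃ Q A)) hf
  rw [LinearMap.toMatrix_comp _ (stdBasis₃ Q A) _ (LinearMap.rTensor _ _),
    LinearMap.toMatrix_comp _ (stdBasis₃ Q A) _ _ (LinearMap.rTensor _ _),
    LinearMap.toMatrix_comp _ (stdBasis₃ Q A) _ _ (LinearMap.rTensor _ _ ∘ₗ _),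
    LinearMap.toMatrix_comp _ (stdBasis₃ Q A) _ (LinearMap.rTensor _ _),
    toMatrix_rTensor, toMatrix_lTensor] at h
  rw [MatYBE, mul_assoc, mul_assoc]
  exact h

theorem toMatrix_eq_permMat (R : YBRack Q)
    {f : ((Q →₀ A) ⊗[A] (Q →₀ A)) →ₗ[A] ((Q →₀ A) ⊗[A] (Q →₀ A))}
    (hf : ∀ x y : Q, f (Finsupp.single x (1 : A) ⊗ₜ[A] Finsupp.single y (1 : A))
      = Finsupp.single y (1 : A) ⊗ₜ[A] Finsupp.single (R.act x y) (1 : A)) :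
    LinearMap.toMatrix (stdBasis₂ Q A) (stdBasis₂ Q A) f = permMat A R.braidPerm := by
  ext i ⟨x, y⟩
  have : Finsupp.single y (1 : A) ⊗ₜ[A] Finsupp.single (R.act x y) (1 : A)
    = stdBasis₂ Q A (R.braidPerm (x, y)) := (stdBasis₂_apply (Q := Q) (A := A) (R.braidPerm (x, y))).symm
  rw [LinearMap.toMatrix_apply, stdBasis₂_apply, hf, this, Module.Basis.repr_self,
    permMat_apply, Finsupp.single_apply]
  simp only [eq_comm]

end MatrixOfEndomorphism

section ConjugationRack

variable {G : Type*} [Group G] {Q : Set G} (R : YBRack Q)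

theorem conj_rack_rho_injective (hZ : Subgroup.center G = ⊥) (hgen : Subgroup.closure Q = ⊤)
    (hR : ∀ x y : Q, ((R.act x y : G)) = (y : G)⁻¹ * (x : G) * (y : G)) :
    Function.Injective R.rho := by
  intro y z h
  have hcomm : (y : G) * (z : G)⁻¹ ∈ Subgroup.center G := by
    have hle : Subgroup.closure Q ≤ Subgroup.centralizer {(y : G) * (z : G)⁻¹} := by
      rw [Subgroup.closure_le]
      intro x hx
      have hxyz : (y : G)⁻¹ * x * y = (z : G)⁻¹ * x * z := by
        rw [← hR ⟨x, hx⟩ y, ← hR ⟨x, hx⟩ z]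
        exact congrArg Subtype.val (Equiv.congr_fun h ⟨x, hx⟩)
      rw [SetLike.mem_coe, Subgroup.mem_centralizer_singleton_iff]
      calc x * (y * (z : G)⁻¹) = y * ((y : G)⁻¹ * x * y) * (z : G)⁻¹ := by group
        _ = y * (z : G)⁻¹ * x := by rw [hxyz]; group
    exact Subgroup.mem_center_iff.2 fun g =>
      Subgroup.mem_centralizer_singleton_iff.1 (hle (hgen ▸ Subgroup.mem_top g))
  rw [hZ, Subgroup.mem_bot, mul_inv_eq_one] at hcomm
  exact Subtype.ext hcomm

theorem conj_rack_transitive (hconj : ∃ g : G, Q = {x | IsConj g x})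
    (hgen : Subgroup.closure Q = ⊤)
    (hR : ∀ x y : Q, ((R.act x y : G)) = (y : G)⁻¹ * (x : G) * (y : G)) (x y : Q) :
    ∃ g ∈ R.Inn, g x = y := by
  have key : ∀ g : G, ∃ k ∈ R.Inn, ∀ x : Q, (k x : G) = g⁻¹ * x * g := by
    intro g
    have hg : g ∈ Subgroup.closure Q := hgen ▸ Subgroup.mem_top g
    induction hg using Subgroup.closure_induction with
    | mem g hg => exact ⟨R.rho ⟨g, hg⟩, Subgroup.subset_closure ⟨_, rfl⟩, fun x => hR x ⟨g, hg⟩⟩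
    | one => exact ⟨1, one_mem _, fun x => by simp⟩
    | mul g h _ _ ihg ihh =>
      obtain ⟨k, hk, hk'⟩ := ihg
      obtain ⟨l, hl, hl'⟩ := ihh
      exact ⟨l * k, mul_mem hl hk, fun x => by
        rw [Equiv.Perm.mul_apply, hl', hk', mul_inv_rev]; simp only [mul_assoc]⟩
    | inv g _ ih =>
      obtain ⟨k, hk, hk'⟩ := ih
      refine ⟨k⁻¹, inv_mem hk, fun x => ?_⟩
      have : (x : G) = g⁻¹ * (k⁻¹ x : Q) * g := by
        rw [← hk' (k⁻¹ x)]
        exact congrArg Subtype.val (k.apply_symm_apply x).symm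
      rw [this]
      group
  obtain ⟨g, rfl⟩ := hconj
  obtain ⟨h, hh⟩ := isConj_iff.1 ((IsConj.symm x.2).trans y.2)
  obtain ⟨k, hk, hk'⟩ := key h⁻¹
  exact ⟨k, hk, Subtype.ext (by rw [hk', inv_inv, hh])⟩

end ConjugationRack

section Gauge

variable {Q A : Type*} [Fintype Q] [CommRing A]

theorem exists_linearEquiv_of_isUnit [DecidableEq Q] {a : Matrix Q Q A} (ha : IsUnit a) :
    ∃ α : (Q →₀ A) ≃ₗ[A] (Q →₀ A),
      LinearMap.toMatrix Finsupp.basisSingleOne Finsupp.basisSingleOne α.toLinearMap = a := by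
  have hdet := (Matrix.isUnit_iff_isUnit_det a).1 ha
  exact ⟨Matrix.toLinearEquiv Finsupp.basisSingleOne a hdet, LinearMap.toMatrix_toLin _ _ _⟩

theorem eq_conj_of_toMatrix [DecidableEq Q] {a : Matrix Q Q A} {α : (Q →₀ A) ≃ₗ[A] (Q →₀ A)}
    (hα : LinearMap.toMatrix Finsupp.basisSingleOne Finsupp.basisSingleOne α.toLinearMap = a)
    {c c' : ((Q →₀ A) ⊗[A] (Q →₀ A)) →ₗ[A] ((Q →₀ A) ⊗[A] (Q →₀ A))}
    (h : LinearMap.toMatrix (stdBasis₂ Q A) (stdBasis₂ Q A) c' * (a ⊗ₖ a)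
      = (a ⊗ₖ a) * LinearMap.toMatrix (stdBasis₂ Q A) (stdBasis₂ Q A) c) :
    c' = (TensorProduct.congr α α).toLinearMap ∘ₗ c ∘ₗ
      (TensorProduct.congr α α).symm.toLinearMap := by
  have hαα : LinearMap.toMatrix (stdBasis₂ Q A) (stdBasis₂ Q A)
      (TensorProduct.congr α α).toLinearMap = a ⊗ₖ a := by
    rw [stdBasis₂, ← hα, ← TensorProduct.toMatrix_map]
    rfl
  rw [← hαα, ← LinearMap.toMatrix_comp, ← LinearMap.toMatrix_comp] at h
  have h' := (LinearMap.toMatrix (stdBasis₂ Q A) (stdBasis₂ Q A)).injective h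
  refine LinearMap.ext fun x => ?_
  have := LinearMap.congr_fun h' ((TensorProduct.congr α α).symm x)
  simpa only [LinearMap.comp_apply, LinearEquiv.coe_coe, LinearEquiv.apply_symm_apply] using this

end Gauge
/-- (Rigidity.) Let `G` be a finite centreless group generated by
a conjugacy class `Q`, regarded as a rack by conjugation.  Then over `ℚ⟦h⟧` with
`m = (h)`, every Yang–Baxter deformation of `c_Q` is equivalent to a rescaling
`s • c_Q` with `s ≡ 1 mod (h)`; that is, `c_Q` is rigid. -/
theorem conjugation_rack_rigid
    {G : Type*} [Group G] [Fintype G] (hZ : Subgroup.center G = ⊥)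
    (Q : Set G) (hconj : ∃ g : G, Q = {x | IsConj g x})
    (hgen : Subgroup.closure Q = ⊤)
    (R : YBRack Q) (hR : ∀ x y : Q, ((R.act x y : G)) = (y : G)⁻¹ * (x : G) * (y : G))
    (cQ : ((Q →₀ PowerSeries ℚ) ⊗[PowerSeries ℚ] (Q →₀ PowerSeries ℚ)) →ₗ[PowerSeries ℚ]
      ((Q →₀ PowerSeries ℚ) ⊗[PowerSeries ℚ] (Q →₀ PowerSeries ℚ)))
    (hcQ : ∀ x y : Q,
      cQ (Finsupp.single x (1 : PowerSeries ℚ) ⊗ₜ[PowerSeries ℚ]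
            Finsupp.single y (1 : PowerSeries ℚ))
        = Finsupp.single y (1 : PowerSeries ℚ) ⊗ₜ[PowerSeries ℚ]
            Finsupp.single (R.act x y) (1 : PowerSeries ℚ))
    (c : ((Q →₀ PowerSeries ℚ) ⊗[PowerSeries ℚ] (Q →₀ PowerSeries ℚ)) →ₗ[PowerSeries ℚ]
      ((Q →₀ PowerSeries ℚ) ⊗[PowerSeries ℚ] (Q →₀ PowerSeries ℚ)))
    (hc : IsYBOp c)
    (hdef : ∀ p q : Q × Q,
      mat2 (PowerSeries ℚ) c p q - mat2 (PowerSeries ℚ) cQ p q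
        ∈ Ideal.span {(PowerSeries.X : PowerSeries ℚ)}) :
    ∃ s : PowerSeries ℚ, s - 1 ∈ Ideal.span {(PowerSeries.X : PowerSeries ℚ)} ∧
      YBEquivalent (Ideal.span {(PowerSeries.X : PowerSeries ℚ)}) (s • cQ) c := by
  classical
  have : Fintype Q := Fintype.ofFinite Q
  have htr := conj_rack_transitive R hconj hgen hR
  have hf := conj_rack_rho_injective R hZ hgen hR
  have hcQ' := toMatrix_eq_permMat R hcQ
  have hM₀ : (LinearMap.toMatrix (stdBasis₂ Q (PowerSeries ℚ)) (stdBasis₂ Q (PowerSeries ℚ))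
      c).map (PowerSeries.constantCoeff (R := ℚ)) = permMat ℚ R.braidPerm := by
    rw [← permMat_map (PowerSeries.constantCoeff (R := ℚ)), ← hcQ']
    ext q p
    have := PowerSeries.X_dvd_iff.1 (Ideal.mem_span_singleton.1 (hdef p q))
    rw [map_sub, sub_eq_zero] at this
    rwa [Matrix.map_apply, Matrix.map_apply, toMatrix_stdBasis₂_apply, toMatrix_stdBasis₂_apply]
  obtain ⟨a, s, ha, hs, hMa⟩ := R.exists_gauge htr hf hc.2.matYBE hM₀
  obtain ⟨α, hα⟩ := exists_linearEquiv_of_isUnit (isUnit_of_map_constantCoeff_eq_one ha)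
  refine ⟨s, Ideal.mem_span_singleton.2 (PowerSeries.X_dvd_iff.2 (by simp [hs])), α,
    fun x u => Ideal.mem_span_singleton.2 (PowerSeries.X_dvd_iff.2 ?_),
    eq_conj_of_toMatrix hα ?_⟩
  · have h₁ : α (Finsupp.single x 1) u = a u x := by
      rw [← hα, LinearMap.toMatrix_apply]
      simp
    have h₂ := congrFun (congrFun ha u) x
    rw [Matrix.map_apply, Matrix.one_apply] at h₂
    rw [h₁, map_sub, h₂]
    by_cases h : x = u <;> simp [h, eq_comm]
  · rw [map_smul, hcQ', Matrix.mul_smul]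
    exact hMa

end
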